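/- Let λ > 1, β = λ/(λ−1), let D_1, D_2, … be i.i.d. Poisson(λ) random variables, and set S_i = (Σ_{j=1}^i D_j) − (i−1) and ρ_i = D_i/S_i (defined on the event S_i > 0). Then, conditionally on the event {S_i > 0 for all 1 ≤ i ≤ m}, the quantity ( Σ_{i=1}^m ρ_i(1−ρ_i) − β·log m ) / (log log m) is bounded in probability as m → ∞: for every ε > 0 there exists K > 0 such that for all large m, the conditional probability that |Σ_{i=1}^m ρ_i(1−ρ_i) − β·log m| > K·log log m, given {S_i > 0 for all i ≤ m}, is at most ε. -/

import Mathlib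

open MeasureTheory ProbabilityTheory Filter Real
open scoped ENNReal NNReal

noncomputable section

/-- The Poisson distribution with parameter `l` on `ℕ`. -/
def poissonDist (l : ℝ) : Measure ℕ :=
  Measure.count.withDensity (fun n => ENNReal.ofReal (Real.exp (-l) * l ^ n / n.factorial))

theorem pvt_poisson_eq (l : ℝ≥0) : poissonDist l = poissonMeasure l := by
  refine Measure.ext_of_singleton fun n => ?_
  rw [poissonMeasure_singleton, poissonDist, withDensity_apply _ (measurableSet_singleton n)]
  simp

theorem pvt_memLp (l : ℝ≥0) : MemLp (fun n : ℕ => (n : ℝ)) 2 (poissonMeasure l) := by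
  rw [memLp_two_iff_integrable_sq (by fun_prop), integrable_poissonMeasure_iff]
  have h := (NormedSpace.expSeries_div_hasSum_exp (4 * (l : ℝ))).summable.mul_left (exp (-l))
  refine Summable.of_nonneg_of_le (fun n => by positivity) (fun n => ?_) h
  have h1 : (n : ℝ) ^ 2 ≤ 4 ^ n := by
    have : (n : ℝ) ≤ 2 ^ n := by exact_mod_cast (Nat.lt_two_pow_self (n := n)).le
    calc (n : ℝ) ^ 2 ≤ (2 ^ n) ^ 2 := by gcongr
      _ = 4 ^ n := by rw [← pow_mul, mul_comm, pow_mul]; norm_num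
  rw [Real.norm_of_nonneg (by positivity), mul_pow]
  have : exp (-(l : ℝ)) * l ^ n / n.factorial * n ^ 2 ≤ exp (-(l : ℝ)) * l ^ n / n.factorial * 4 ^ n := by
    gcongr
  calc _ ≤ _ := this
    _ = _ := by ring

theorem pvt_mean (l : ℝ≥0) : ∫ n : ℕ, (n : ℝ) ∂(poissonMeasure l) = l := by
  rw [integral_poissonMeasure]
  have h := (NormedSpace.expSeries_div_hasSum_exp (l : ℝ)).mul_left (exp (-l) * l)
  have h2 : HasSum (fun n : ℕ => (exp (-(l : ℝ)) * l ^ n / (n.factorial : ℝ)) • (n : ℝ)) (l : ℝ) := by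
    rw [← hasSum_nat_add_iff' 1]
    convert! h using 1
    · funext n
      rw [Nat.factorial_succ]
      have : (n.factorial : ℝ) ≠ 0 := by positivity
      have : (n + 1 : ℝ) ≠ 0 := by positivity
      push_cast
      simp only [smul_eq_mul]
      field_simp
      ring
    · rw [← Real.exp_eq_exp_ℝ, mul_right_comm, ← Real.exp_add]
      simp
  exact h2.tsum_eq

theorem pvt_ae_summable {Ω : Type} [MeasurableSpace Ω] (μ : Measure Ω) (f : ℕ → Ω → ℝ)
    (h0 : ∀ i ω, 0 ≤ f i ω) (hm : ∀ i, Integrable (f i) μ) (b : ℕ → ℝ) (hb : Summable b)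
    (hfb : ∀ i, ∫ ω, f i ω ∂μ ≤ b i) :
    ∀ᵐ ω ∂μ, Summable (fun i => f i ω) := by
  have hb0 : ∀ i, 0 ≤ b i := fun i => (integral_nonneg (h0 i)).trans (hfb i)
  have h1 : ∫⁻ ω, ∑' i, ENNReal.ofReal (f i ω) ∂μ ≠ ∞ := by
    rw [lintegral_tsum (fun i => (hm i).aemeasurable.ennreal_ofReal)]
    refine ne_top_of_le_ne_top hb.tsum_ofReal_ne_top (ENNReal.tsum_le_tsum fun i => ?_)
    rw [← ofReal_integral_eq_lintegral_ofReal (hm i) (Eventually.of_forall (h0 i))]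
    exact ENNReal.ofReal_le_ofReal (hfb i)
  have h2 := ae_lt_top' (AEMeasurable.tsum
    (fun i => (hm i).aemeasurable.ennreal_ofReal)) h1
  filter_upwards [h2] with ω hω
  have := ENNReal.summable_toReal hω.ne
  simpa [ENNReal.toReal_ofReal (h0 _ ω)] using this

theorem pvt_events {Ω : Type} [MeasurableSpace Ω] (μ : Measure Ω) [IsProbabilityMeasure μ]
    (F : ℕ → Set Ω) (hF : Antitone F) (hm : ∀ n, MeasurableSet (F n))
    (h : ∀ᵐ ω ∂μ, ∃ n, ω ∉ F n) (δ : ℝ≥0∞) (hδ : 0 < δ) : ∃ N, μ (F N) ≤ δ := by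
  have h1 : μ (⋂ n, F n) = 0 := by
    rw [measure_eq_zero_iff_ae_notMem]
    filter_upwards [h] with ω ⟨n, hn⟩ hω
    exact hn (Set.mem_iInter.1 hω n)
  have h2 := tendsto_measure_iInter_atTop (μ := μ) (fun n => (hm n).nullMeasurableSet) hF
    ⟨0, measure_ne_top _ _⟩
  rw [h1] at h2
  obtain ⟨N, hN⟩ := (h2.eventually (gt_mem_nhds hδ)).exists
  exact ⟨N, hN.le⟩

theorem pvt_summable_base : Summable (fun i : ℕ => √(i : ℝ) / (i : ℝ) ^ 2) := by
  have h := (Real.summable_one_div_nat_rpow (p := 3 / 2)).2 (by norm_num)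
  refine h.congr fun i => ?_
  rcases Nat.eq_zero_or_pos i with rfl | hi
  · simp
  have hi' : (0 : ℝ) < i := by exact_mod_cast hi
  rw [Real.sqrt_eq_rpow, ← Real.rpow_natCast, ← Real.rpow_sub hi', one_div, ← Real.rpow_neg hi'.le]
  norm_num

theorem pvt_det (a : ℝ) (ha : 0 < a) (d s : ℕ → ℝ) (hd : ∀ i, 0 ≤ d i)
    (hs : ∀ᶠ i : ℕ in atTop, a / 2 * (i : ℝ) ≤ s i)
    (h1 : Summable fun i : ℕ => d i ^ 2 * (√(i : ℝ) / (i : ℝ) ^ 2))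
    (h2 : Summable fun i : ℕ => (s i - a * i) ^ 2 / (√(i : ℝ) * (i : ℝ) ^ 2)) :
    ∃ M : ℝ, ∀ m, |∑ i ∈ Finset.Icc 1 m, (d i / s i * (1 - d i / s i) - d i / (a * i))| ≤ M := by
  have hg : Summable fun i : ℕ => |d i / s i * (1 - d i / s i) - d i / (a * i)| := by
    refine Summable.of_norm_bounded_eventually_nat
      (((h1.add h2).mul_left (2 / a ^ 2)).add (h1.mul_left (4 / a ^ 2))) ?_
    filter_upwards [hs, eventually_ge_atTop 1] with i hi hi1
    have hi' : (1 : ℝ) ≤ i := by exact_mod_cast hi1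
    have hi0 : (0 : ℝ) < i := by linarith
    have hsi : 0 < s i := lt_of_lt_of_le (by positivity) hi
    rw [Real.norm_of_nonneg (abs_nonneg _)]
    have e1 : d i / s i * (1 - d i / s i) - d i / (a * i)
        = - (d i * (s i - a * i) / (s i * (a * i))) - d i ^ 2 / s i ^ 2 := by
      field_simp
      ring
    have hr : 1 ≤ √(i : ℝ) := Real.one_le_sqrt.2 hi'
    have hr2 : √(i : ℝ) ^ 2 = i := Real.sq_sqrt hi0.le
    set r := √(i : ℝ)
    set x := s i - a * i
    have b1 : d i * |x| ≤ d i ^ 2 * r + x ^ 2 / r := by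
      have : x ^ 2 / r = |x| ^ 2 / r := by rw [sq_abs]
      rw [this]
      have h3 : 0 ≤ (d i * r - |x|) ^ 2 / r := by positivity
      have h4 : (d i * r - |x|) ^ 2 / r = d i ^ 2 * r + |x| ^ 2 / r - 2 * (d i * |x|) := by
        field_simp
        ring
      nlinarith [mul_nonneg (hd i) (abs_nonneg x)]
    have b2 : |d i * x / (s i * (a * i))| ≤ 2 / a ^ 2 * (d i ^ 2 * (r / (i : ℝ) ^ 2) + x ^ 2 / (r * (i : ℝ) ^ 2)) := by
      rw [abs_div, abs_mul, abs_of_nonneg (hd i), abs_of_pos (by positivity : 0 < s i * (a * i))]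
      calc d i * |x| / (s i * (a * i)) ≤ (d i ^ 2 * r + x ^ 2 / r) / (a / 2 * i * (a * i)) := by
            gcongr
        _ = _ := by field_simp
    have b3 : d i ^ 2 / s i ^ 2 ≤ 4 / a ^ 2 * (d i ^ 2 * (r / (i : ℝ) ^ 2)) := by
      calc d i ^ 2 / s i ^ 2 ≤ d i ^ 2 / (a / 2 * i) ^ 2 := by gcongr
        _ = 4 / a ^ 2 * (d i ^ 2 * (1 / (i : ℝ) ^ 2)) := by field_simp; norm_num
        _ ≤ _ := by gcongr
    rw [e1]
    calc _ ≤ |-(d i * x / (s i * (a * i)))| + |d i ^ 2 / s i ^ 2| := abs_sub _ _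
      _ ≤ _ := by
        rw [abs_neg, abs_of_nonneg (by positivity : 0 ≤ d i ^ 2 / s i ^ 2)]
        exact add_le_add b2 b3
  refine ⟨_, fun m => (Finset.abs_sum_le_sum_abs _ _).trans (hg.sum_le_tsum _ fun i _ => abs_nonneg _)⟩

theorem pvt_harm (m : ℕ) (hm : 1 ≤ m) :
    |∑ i ∈ Finset.Icc 1 m, (1 / (i : ℝ)) - Real.log m| ≤ 1 := by
  have h1 := harmonic_le_one_add_log m
  have h2 := log_add_one_le_harmonic m
  have h3 : ((harmonic m : ℚ) : ℝ) = ∑ i ∈ Finset.Icc 1 m, (1 / (i : ℝ)) := by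
    simp [harmonic_eq_sum_Icc]
  have h4 : Real.log m ≤ Real.log ((m + 1 : ℕ) : ℝ) := by
    apply Real.log_le_log
    · exact_mod_cast hm
    · push_cast; linarith
  rw [h3] at h1 h2
  rw [abs_le]
  constructor <;> linarith

theorem pvt_cheb {Ω : Type} [MeasurableSpace Ω] (μ : Measure Ω) [IsProbabilityMeasure μ]
    (X : ℕ → Ω → ℝ) (lam v : ℝ) (hX : ∀ i, MemLp (X i) 2 μ) (hE : ∀ i, ∫ ω, X i ω ∂μ = lam)
    (hV : ∀ i, Var[X i; μ] = v) (hind : iIndepFun X μ) (M : ℝ) (hM : 0 < M) (m : ℕ) :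
    μ {ω | M ≤ |∑ i ∈ Finset.Icc 1 m, (X i ω - lam) / i|} ≤
      ENNReal.ofReal (v * (∑' i : ℕ, 1 / (i : ℝ) ^ 2) / M ^ 2) := by
  have hv : 0 ≤ v := hV 0 ▸ variance_nonneg _ _
  let Y : ℕ → Ω → ℝ := fun i ω => (1 / (i : ℝ)) * X i ω
  have hY : ∀ i, MemLp (Y i) 2 μ := fun i => (hX i).const_mul _
  have hYsum : MemLp (∑ i ∈ Finset.Icc 1 m, Y i) 2 μ := memLp_finsetSum' _ fun i _ => hY i
  have hmean : ∫ ω, (∑ i ∈ Finset.Icc 1 m, Y i) ω ∂μ = ∑ i ∈ Finset.Icc 1 m, 1 / (i : ℝ) * lam := by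
    simp only [Finset.sum_apply]
    rw [integral_finsetSum _ fun i _ => (hY i).integrable (by norm_num)]
    refine Finset.sum_congr rfl fun i _ => ?_
    rw [integral_const_mul, hE]
  have hvar : Var[∑ i ∈ Finset.Icc 1 m, Y i; μ] ≤ v * (∑' i : ℕ, 1 / (i : ℝ) ^ 2) := by
    rw [IndepFun.variance_sum (fun i _ => hY i)]
    · have : ∀ i ∈ Finset.Icc 1 m, Var[Y i; μ] = v * (1 / (i : ℝ) ^ 2) := by
        intro i _
        rw [variance_const_mul, hV]
        ring
      rw [Finset.sum_congr rfl this, ← Finset.mul_sum]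
      gcongr
      exact (Real.summable_one_div_nat_pow.2 (by norm_num)).sum_le_tsum _ fun i _ => by positivity
    · intro i _ j _ hij
      exact (hind.indepFun hij).comp (measurable_const_mul _) (measurable_const_mul _)
  have h := meas_ge_le_variance_div_sq hYsum hM
  rw [hmean] at h
  have e : {ω | M ≤ |∑ i ∈ Finset.Icc 1 m, (X i ω - lam) / i|} =
      {ω | M ≤ |(∑ i ∈ Finset.Icc 1 m, Y i) ω - ∑ i ∈ Finset.Icc 1 m, 1 / (i : ℝ) * lam|} := by
    ext ω
    simp only [Set.mem_ofPred_eq, Finset.sum_apply, ← Finset.sum_sub_distrib, Y]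
    have : ∀ i ∈ Finset.Icc 1 m, (X i ω - lam) / (i : ℝ) = 1 / (i : ℝ) * X i ω - 1 / (i : ℝ) * lam := by
      intro i _; ring
    rw [Finset.sum_congr rfl this]
  rw [e]
  refine h.trans (ENNReal.ofReal_le_ofReal ?_)
  gcongr

theorem pvt_slln {Ω : Type} [MeasurableSpace Ω] (μ : Measure Ω) [IsProbabilityMeasure μ]
    (X : ℕ → Ω → ℝ) (lam : ℝ) (hlam : 1 < lam) (hX : ∀ i, MemLp (X i) 2 μ)
    (hE : ∀ i, ∫ ω, X i ω ∂μ = lam)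
    (hid : ∀ i j, IdentDistrib (X i) (X j) μ μ) (hind : iIndepFun X μ) :
    ∀ᵐ ω ∂μ, ∀ᶠ i : ℕ in atTop,
      (lam - 1) / 2 * (i : ℝ) ≤ ∑ j ∈ Finset.Icc 1 i, X j ω - ((i : ℝ) - 1) := by
  have h := strong_law_ae_real (μ := μ) (fun i => X (i + 1)) ((hX _).integrable (by norm_num))
    (fun i j hij => hind.indepFun (by simpa using hij)) (fun i => hid _ _)
  filter_upwards [h] with ω hω
  rw [hE] at hω
  have := hω.eventually (lt_mem_nhds (show (lam + 1) / 2 < lam by linarith))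
  filter_upwards [this, eventually_ge_atTop 1] with i hi hi1
  have hi0 : (0 : ℝ) < i := by exact_mod_cast hi1
  rw [lt_div_iff₀ hi0] at hi
  have e : ∑ j ∈ Finset.range i, X (j + 1) ω = ∑ j ∈ Finset.Icc 1 i, X j ω := by
    rw [Finset.range_eq_Ico, Finset.sum_Ico_add' (fun j => X j ω) 0 i 1]
    rfl
  rw [e] at hi
  linarith

theorem pvt_var_walk {Ω : Type} [MeasurableSpace Ω] (μ : Measure Ω) [IsProbabilityMeasure μ]
    (X : ℕ → Ω → ℝ) (lam v : ℝ) (hX : ∀ i, MemLp (X i) 2 μ) (hE : ∀ i, ∫ ω, X i ω ∂μ = lam)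
    (hV : ∀ i, Var[X i; μ] = v) (hind : iIndepFun X μ) (m : ℕ) :
    MemLp (fun ω => (∑ j ∈ Finset.Icc 1 m, X j ω - ((m : ℝ) - 1)) - (lam - 1) * m) 2 μ ∧
    ∫ ω, ((∑ j ∈ Finset.Icc 1 m, X j ω - ((m : ℝ) - 1)) - (lam - 1) * m) ^ 2 ∂μ = v * m + 1 := by
  have hs : MemLp (∑ j ∈ Finset.Icc 1 m, X j) 2 μ := memLp_finsetSum' _ fun i _ => hX i
  have hmean : ∫ ω, (∑ i ∈ Finset.Icc 1 m, X i) ω ∂μ = m * lam := by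
    simp only [Finset.sum_apply]
    rw [integral_finsetSum _ fun i _ => (hX i).integrable (by norm_num)]
    simp [hE]
  have hvar : Var[∑ i ∈ Finset.Icc 1 m, X i; μ] = m * v := by
    rw [IndepFun.variance_sum (fun i _ => hX i) (fun i _ j _ hij => hind.indepFun hij)]
    simp [hV]
  have hW : MemLp (fun ω => (∑ j ∈ Finset.Icc 1 m, X j ω - ((m : ℝ) - 1)) - (lam - 1) * m) 2 μ := by
    have := hs.sub (memLp_const (((m : ℝ) - 1) + (lam - 1) * m))
    refine this.ae_eq (Eventually.of_forall fun ω => ?_)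
    simp only [Pi.sub_apply, Finset.sum_apply]
    ring
  refine ⟨hW, ?_⟩
  have e1 : (fun ω => (∑ j ∈ Finset.Icc 1 m, X j ω - ((m : ℝ) - 1)) - (lam - 1) * m)
      = fun ω => (∑ j ∈ Finset.Icc 1 m, X j) ω - (((m : ℝ) - 1) + (lam - 1) * m) := by
    funext ω
    simp only [Finset.sum_apply]
    ring
  have e2 := variance_eq_sub hW
  rw [e1, variance_sub_const hs.1, hvar, ← e1] at e2
  have e3 : ∫ ω, ((∑ j ∈ Finset.Icc 1 m, X j ω - ((m : ℝ) - 1)) - (lam - 1) * m) ∂μ = 1 := by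
    rw [e1, integral_sub (hs.integrable (by norm_num)) (integrable_const _), hmean]
    simp
    ring
  rw [e3] at e2
  simp only [Pi.pow_apply] at e2
  linarith

theorem pvt_ae_bdd {Ω : Type} [MeasurableSpace Ω] (μ : Measure Ω) [IsProbabilityMeasure μ]
    (X : ℕ → Ω → ℝ) (lam v : ℝ) (hlam : 1 < lam) (h0 : ∀ i ω, 0 ≤ X i ω)
    (hX : ∀ i, MemLp (X i) 2 μ) (hE : ∀ i, ∫ ω, X i ω ∂μ = lam)
    (hid : ∀ i j, IdentDistrib (X i) (X j) μ μ)
    (hV : ∀ i, Var[X i; μ] = v) (hind : iIndepFun X μ) (s : ℕ → Ω → ℝ)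
    (hs : ∀ i ω, s i ω = ∑ j ∈ Finset.Icc 1 i, X j ω - ((i : ℝ) - 1)) :
    ∀ᵐ ω ∂μ, ∃ M : ℝ, ∀ m, |∑ i ∈ Finset.Icc 1 m, (X i ω / s i ω * (1 - X i ω / s i ω)
      - X i ω / ((lam - 1) * i))| ≤ M := by
  have hv : 0 ≤ v := hV 0 ▸ variance_nonneg _ _
  have h2 : ∀ i, ∫ ω, X i ω ^ 2 ∂μ = v + lam ^ 2 := by
    intro i
    have := variance_eq_sub (hX i)
    rw [hE, hV] at this
    simp only [Pi.pow_apply] at this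
    linarith
  have A := pvt_ae_summable μ (fun i ω => X i ω ^ 2 * (√(i : ℝ) / (i : ℝ) ^ 2))
    (fun i ω => by positivity) (fun i => (hX i).integrable_sq.mul_const _)
    (fun i => (v + lam ^ 2) * (√(i : ℝ) / (i : ℝ) ^ 2)) (pvt_summable_base.mul_left _)
    (fun i => by rw [integral_mul_const, h2])
  have B := pvt_ae_summable μ (fun i ω => (s i ω - (lam - 1) * i) ^ 2 / (√(i : ℝ) * (i : ℝ) ^ 2))
    (fun i ω => by positivity)
    (fun i => by
      simp only [hs]
      exact (pvt_var_walk μ X lam v hX hE hV hind i).1.integrable_sq.div_const _)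
    (fun i => (v + 1) * (√(i : ℝ) / (i : ℝ) ^ 2)) (pvt_summable_base.mul_left _)
    (fun i => by
      rw [integral_div]
      simp only [hs]
      rw [(pvt_var_walk μ X lam v hX hE hV hind i).2]
      rcases Nat.eq_zero_or_pos i with rfl | hi
      · simp
      have hi' : (1 : ℝ) ≤ i := by exact_mod_cast hi
      have hr : 0 < √(i : ℝ) := Real.sqrt_pos.2 (by linarith)
      have hr2 : √(i : ℝ) * √(i : ℝ) = i := Real.mul_self_sqrt (by linarith)
      have : (v + 1) * (√(i : ℝ) / (i : ℝ) ^ 2) = ((v + 1) * i) / (√(i : ℝ) * (i : ℝ) ^ 2) := by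
        rw [← mul_div_assoc, div_eq_div_iff (by positivity) (by positivity)]
        linear_combination (v + 1) * (i : ℝ) ^ 2 * hr2
      rw [this]
      gcongr
      linarith)
  filter_upwards [A, B, pvt_slln μ X lam hlam hX hE hid hind] with ω hA hB hC
  refine pvt_det (lam - 1) (by linarith) (fun i => X i ω) (fun i => s i ω) (fun i => h0 i ω) ?_ hA hB
  simpa only [hs] using hC

theorem pvt_pos {Ω : Type} [MeasurableSpace Ω] (μ : Measure Ω) [IsProbabilityMeasure μ]
    (D : ℕ → Ω → ℕ) (hmeas : ∀ i, Measurable (D i)) (hindep : iIndepFun D μ)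
    (hpos : ∀ k, μ {ω | D 1 ω = k} ≠ 0) (S : ℕ → Ω → ℤ)
    (hS : ∀ j ω, S j ω = (∑ i ∈ Finset.Icc 1 j, (D i ω : ℤ)) - ((j : ℤ) - 1))
    (hSm : ∀ i, Measurable (S i))
    (hev : ∀ᵐ ω ∂μ, ∀ᶠ i : ℕ in atTop, 0 ≤ S i ω) :
    ∃ p : ℝ≥0∞, p ≠ 0 ∧ ∀ m : ℕ, p ≤ μ {ω | ∀ i : ℕ, 1 ≤ i → i ≤ m → 0 < S i ω} := by
  let F : ℕ → Set Ω := fun N => {ω | ∃ n, 1 ≤ n ∧ S n ω + N < D 1 ω}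
  obtain ⟨N, hN⟩ := pvt_events μ F
    (fun a b hab ω ⟨n, h1, h2⟩ => ⟨n, h1, by
      have : (a : ℤ) ≤ b := by exact_mod_cast hab
      linarith⟩)
    (fun N => by
      have : F N = ⋃ n, ⋃ (_ : 1 ≤ n), {ω | S n ω + N < (D 1 ω : ℤ)} := by
        ext ω; simp [F]
      rw [this]
      refine MeasurableSet.iUnion fun n => MeasurableSet.iUnion fun _ => ?_
      refine measurableSet_lt ((hSm n).add_const _) ?_
      exact (measurable_from_top (f := fun n : ℕ => (n : ℤ))).comp (hmeas 1))
    (by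
      filter_upwards [hev] with ω hω
      obtain ⟨n0, hn0⟩ := eventually_atTop.1 hω
      refine ⟨D 1 ω + n0, ?_⟩
      rintro ⟨n, h1, h2⟩
      push_cast at h2
      rcases le_or_gt n0 n with h | h
      · have := hn0 n h
        omega
      · rw [hS] at h2
        have : 0 ≤ ∑ i ∈ Finset.Icc 1 n, (D i ω : ℤ) := Finset.sum_nonneg fun i _ => by positivity
        omega)
    (1 / 2) (by norm_num)
  refine ⟨μ {ω | D 1 ω = N + 1} * (1 / 2), mul_ne_zero (hpos _) (by norm_num), fun m => ?_⟩
  let T := Finset.Icc 2 m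
  let Aset : Set (({1} : Finset ℕ) → ℕ) := {t | t ⟨1, by simp⟩ = N + 1}
  let Bset : Set (T → ℕ) := {t | ∀ n, 1 ≤ n → n ≤ m →
    (n : ℤ) - 1 ≤ (∑ i : T, if (i : ℕ) ≤ n then (t i : ℤ) else 0) + N}
  have hI := hindep.indepFun_finset {1} T (by simp [T]) hmeas
  have hI2 := hI.measure_inter_preimage_eq_mul Aset Bset
    (Set.to_countable _).measurableSet (Set.to_countable _).measurableSet
  have hA : (fun a (i : ({1} : Finset ℕ)) => D i a) ⁻¹' Aset = {ω | D 1 ω = N + 1} := by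
    ext ω; simp [Aset]
  have key : ∀ n ω, 1 ≤ n → n ≤ m →
      (∑ i : T, if (i : ℕ) ≤ n then (D i ω : ℤ) else 0) = S n ω + ((n : ℤ) - 1) - D 1 ω := by
    intro n ω h1 h2
    rw [Finset.sum_coe_sort T (fun i => if i ≤ n then (D i ω : ℤ) else 0), ← Finset.sum_filter]
    have : T.filter (· ≤ n) = Finset.Icc 2 n := by
      ext i; simp [T]; omega
    rw [this, hS]
    have h3 : Finset.Icc 1 n = insert 1 (Finset.Icc 2 n) := by
      ext i; simp; omega
    rw [h3, Finset.sum_insert (by simp)]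
    ring
  have hB : (F N)ᶜ ⊆ (fun a (i : T) => D i a) ⁻¹' Bset := by
    intro ω hω n h1 h2
    show (n : ℤ) - 1 ≤ (∑ i : T, if (i : ℕ) ≤ n then (D i ω : ℤ) else 0) + N
    rw [key n ω h1 h2]
    by_contra hcon
    exact hω ⟨n, h1, by omega⟩
  have hB2 : (1 / 2 : ℝ≥0∞) ≤ μ ((fun a (i : T) => D i a) ⁻¹' Bset) := by
    refine le_trans ?_ (measure_mono hB)
    have h1 : (1 : ℝ≥0∞) ≤ μ (F N) + μ (F N)ᶜ := by
      rw [← measure_univ (μ := μ), ← Set.union_compl_self (F N)]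
      exact measure_union_le _ _
    have h2 : (1 : ℝ≥0∞) ≤ 1 / 2 + μ (F N)ᶜ := h1.trans (by gcongr)
    have h3 : (1 / 2 + 1 / 2 : ℝ≥0∞) ≤ 1 / 2 + μ (F N)ᶜ := (ENNReal.add_halves 1).le.trans h2
    exact (ENNReal.add_le_add_iff_left (by simp : (1 / 2 : ℝ≥0∞) ≠ ∞)).1 h3
  calc _ ≤ _ := mul_le_mul_right hB2 _
    _ = _ := by rw [← hA, ← hI2]
    _ ≤ _ := measure_mono ?_
  rintro ω ⟨h1, h2⟩ n hn1 hn2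
  rw [hA] at h1
  have h1' : D 1 ω = N + 1 := h1
  have h3 : (n : ℤ) - 1 ≤ (∑ i : T, if (i : ℕ) ≤ n then (D i ω : ℤ) else 0) + N := h2 n hn1 hn2
  rw [key n ω hn1 hn2] at h3
  omega

/-- **Conditional tightness of the variance proxy** (Proposition 3.6(c) of
Bhamidi–van der Hofstad–Hooghiemstra): for `D₁, D₂, …` i.i.d. Poisson(λ), `λ > 1`,
`S_i = Σ_{j≤i} D_j - (i-1)`, `ρ_i = D_i/S_i` and `β = λ/(λ-1)`, conditionally on
`{S_i > 0 ∀ i ≤ m}`, the quantity `(Σ_{i≤m} ρ_i(1-ρ_i) - β log m)/(log log m)` is bounded in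
probability as `m → ∞`. -/
theorem poisson_variance_tightness
    (lam : ℝ) (hlam : 1 < lam) (β : ℝ) (hβ : β = lam / (lam - 1))
    (Ω : Type) [MeasurableSpace Ω] (μ : Measure Ω) [IsProbabilityMeasure μ]
    (D : ℕ → Ω → ℕ)
    (hmeas : ∀ i, Measurable (D i))
    (hindep : iIndepFun D μ)
    (hlaw : ∀ i, μ.map (D i) = poissonDist lam)
    (S : ℕ → Ω → ℤ)
    (hS : ∀ j ω, S j ω = (∑ i ∈ Finset.Icc 1 j, (D i ω : ℤ)) - ((j : ℤ) - 1))
    (ρ : ℕ → Ω → ℝ)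
    (hρ : ∀ i ω, ρ i ω = (D i ω : ℝ) / ((S i ω : ℤ) : ℝ))
    (Pos : ℕ → Set Ω)
    (hPos : ∀ m, Pos m = {ω | ∀ i : ℕ, 1 ≤ i → i ≤ m → 0 < S i ω}) :
    ∀ ε : ℝ, 0 < ε → ∃ K : ℝ, 0 < K ∧
      ∀ᶠ m : ℕ in atTop,
        μ[|Pos m] {ω | K * Real.log (Real.log m) <
            |(∑ i ∈ Finset.Icc 1 m, ρ i ω * (1 - ρ i ω)) - β * Real.log m|}
          ≤ ENNReal.ofReal ε := by
  intro ε hε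
  lift lam to ℝ≥0 using by linarith with l
  have hlaw' : ∀ i, μ.map (D i) = poissonMeasure l := fun i => by rw [hlaw, pvt_poisson_eq]
  set X : ℕ → Ω → ℝ := fun i ω => (D i ω : ℝ) with hXdef
  have hcast : Measurable (fun n : ℕ => (n : ℝ)) := measurable_from_top
  have hXm : ∀ i, Measurable (X i) := fun i => hcast.comp (hmeas i)
  have hX : ∀ i, MemLp (X i) 2 μ := fun i => by
    have := pvt_memLp l
    rw [← hlaw' i] at this
    exact (memLp_map_measure_iff hcast.aestronglyMeasurable (hmeas i).aemeasurable).1 this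
  have hE : ∀ i, ∫ ω, X i ω ∂μ = l := fun i => by
    have := pvt_mean l
    rw [← hlaw' i, integral_map (hmeas i).aemeasurable hcast.aestronglyMeasurable] at this
    exact this
  have hid : ∀ i j, IdentDistrib (X i) (X j) μ μ := fun i j => by
    have : IdentDistrib (D i) (D j) μ μ :=
      ⟨(hmeas i).aemeasurable, (hmeas j).aemeasurable, by rw [hlaw', hlaw']⟩
    exact this.comp hcast
  have hind : iIndepFun X μ := hindep.comp (fun _ n => (n : ℝ)) (fun _ => hcast)
  have hV : ∀ i, Var[X i; μ] = Var[X 0; μ] := fun i => (hid i 0).variance_eq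
  have hs : ∀ i ω, ((S i ω : ℤ) : ℝ) = ∑ j ∈ Finset.Icc 1 i, X j ω - ((i : ℝ) - 1) := by
    intro i ω
    rw [hS]
    push_cast
    rfl
  have hSm : ∀ i, Measurable (S i) := by
    intro i
    have : S i = fun ω => (∑ j ∈ Finset.Icc 1 i, (D j ω : ℤ)) - ((i : ℤ) - 1) := funext (hS i)
    rw [this]
    refine Measurable.sub_const (Finset.measurable_sum _ fun j _ => ?_) _
    exact (measurable_from_top (f := fun n : ℕ => (n : ℤ))).comp (hmeas j)
  have hSr : ∀ i, Measurable (fun ω => ((S i ω : ℤ) : ℝ)) := fun i =>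
    (measurable_from_top (f := fun n : ℤ => (n : ℝ))).comp (hSm i)
  have hl0 : (0 : ℝ) < l := by linarith
  have ha : (0 : ℝ) < (l : ℝ) - 1 := by linarith
  -- lower bound on the probability of the conditioning event
  obtain ⟨p, hp0, hp⟩ := pvt_pos μ D hmeas hindep
    (fun k => by
      have e : μ {ω | D 1 ω = k} = μ.map (D 1) {k} := by
        rw [Measure.map_apply (hmeas 1) (measurableSet_singleton k)]; rfl
      rw [e, hlaw', poissonMeasure_singleton]
      simp only [ne_eq, ENNReal.ofReal_eq_zero, not_le]
      positivity) S hS hSm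
    (by
      filter_upwards [pvt_slln μ X l hlam hX hE hid hind] with ω hω
      filter_upwards [hω] with i hi
      rw [← hs] at hi
      have : (0 : ℝ) ≤ (S i ω : ℤ) := le_trans (by positivity) hi
      exact_mod_cast this)
  have hp1 : p ≠ ∞ := ne_top_of_le_ne_top (measure_ne_top μ _) (hp 0)
  set δ : ℝ≥0∞ := p * ENNReal.ofReal ε / 2 with hδ
  have hδ0 : 0 < δ := by
    refine ENNReal.div_pos (mul_ne_zero hp0 ?_) (by norm_num)
    simpa using hε
  have hδ1 : δ ≠ ∞ := by
    rw [hδ]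
    exact ENNReal.div_ne_top (ENNReal.mul_ne_top hp1 ENNReal.ofReal_ne_top) (by norm_num)
  -- the almost surely bounded part
  let G : ℕ → Ω → ℝ := fun m ω => ∑ i ∈ Finset.Icc 1 m,
    (X i ω / ((S i ω : ℤ) : ℝ) * (1 - X i ω / ((S i ω : ℤ) : ℝ)) - X i ω / (((l : ℝ) - 1) * i))
  have hGm : ∀ m, Measurable (G m) := fun m => by
    refine Finset.measurable_sum _ fun i _ => ?_
    have h1 := (hXm i).div (hSr i)
    exact (h1.mul (measurable_const.sub h1)).sub ((hXm i).div_const _)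
  have hG := pvt_ae_bdd μ X l _ hlam (fun i ω => Nat.cast_nonneg _) hX hE hid hV hind
    (fun i ω => ((S i ω : ℤ) : ℝ)) hs
  obtain ⟨N, hN⟩ := pvt_events μ (fun N => {ω | ∃ m, (N : ℝ) < |G m ω|})
    (fun a b hab ω ⟨m, h⟩ => ⟨m, lt_of_le_of_lt (by exact_mod_cast hab) h⟩)
    (fun N => by
      have : {ω | ∃ m, (N : ℝ) < |G m ω|} = ⋃ m, {ω | (N : ℝ) < |G m ω|} := by
        ext ω; simp
      rw [this]
      exact MeasurableSet.iUnion fun m => measurableSet_lt measurable_const (hGm m).abs)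
    (by
      filter_upwards [hG] with ω ⟨M, hM⟩
      obtain ⟨N, hN⟩ := exists_nat_ge M
      refine ⟨N, ?_⟩
      rintro ⟨m, hm⟩
      exact absurd (hM m) (not_le.2 (lt_of_le_of_lt hN hm))) δ hδ0
  -- the Chebyshev part
  obtain ⟨M, hM0, hM⟩ : ∃ M : ℝ, 0 < M ∧
      ENNReal.ofReal (Var[X 0; μ] * (∑' i : ℕ, 1 / (i : ℝ) ^ 2) / M ^ 2) ≤ δ := by
    have ht : Tendsto (fun M : ℝ => Var[X 0; μ] * (∑' i : ℕ, 1 / (i : ℝ) ^ 2) / M ^ 2) atTop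
        (nhds 0) := tendsto_const_nhds.div_atTop (tendsto_pow_atTop (by norm_num))
    have hd : 0 < δ.toReal := ENNReal.toReal_pos hδ0.ne' hδ1
    obtain ⟨M, h1, h2⟩ := ((ht.eventually (gt_mem_nhds hd)).and (eventually_gt_atTop 0)).exists
    exact ⟨M, h2, ENNReal.ofReal_le_of_le_toReal h1.le⟩
  have hβ0 : 0 < β := by rw [hβ]; positivity
  refine ⟨N + M / ((l : ℝ) - 1) + β, by positivity, ?_⟩
  have hll : Tendsto (fun m : ℕ => Real.log (Real.log (m : ℝ))) atTop atTop :=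
    Real.tendsto_log_atTop.comp (Real.tendsto_log_atTop.comp tendsto_natCast_atTop_atTop)
  filter_upwards [hll.eventually_ge_atTop 1, eventually_ge_atTop 1] with m hm1 hm2
  have hPm : MeasurableSet (Pos m) := by
    have : Pos m = ⋂ i, ⋂ (_ : 1 ≤ i), ⋂ (_ : i ≤ m), {ω | 0 < S i ω} := by
      rw [hPos]; ext ω; simp
    rw [this]
    exact MeasurableSet.iInter fun i => MeasurableSet.iInter fun _ => MeasurableSet.iInter fun _ =>
      measurableSet_lt measurable_const (hSm i)
  have hpm : p ≤ μ (Pos m) := by rw [hPos]; exact hp m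
  set Bad := {ω | (N + M / ((l : ℝ) - 1) + β) * Real.log (Real.log m) <
            |(∑ i ∈ Finset.Icc 1 m, ρ i ω * (1 - ρ i ω)) - β * Real.log m|} with hBad
  have hsub : Bad ⊆ {ω | ∃ m, (N : ℝ) < |G m ω|} ∪
      {ω | M ≤ |∑ i ∈ Finset.Icc 1 m, (X i ω - l) / i|} := by
    intro ω hω
    have hω' : (N + M / ((l : ℝ) - 1) + β) * Real.log (Real.log m) <
            |(∑ i ∈ Finset.Icc 1 m, ρ i ω * (1 - ρ i ω)) - β * Real.log m| := hω
    by_contra hcon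
    rw [Set.mem_union, not_or] at hcon
    obtain ⟨c1, c2⟩ := hcon
    have d1 : |G m ω| ≤ N := by
      by_contra h
      exact c1 ⟨m, not_le.1 h⟩
    have d2 : |∑ i ∈ Finset.Icc 1 m, (X i ω - l) / i| ≤ M := by
      by_contra h
      exact c2 (not_le.1 h).le
    have d3 := pvt_harm m hm2
    have e : (∑ i ∈ Finset.Icc 1 m, ρ i ω * (1 - ρ i ω)) - β * Real.log m
        = G m ω + (∑ i ∈ Finset.Icc 1 m, (X i ω - l) / i) / ((l : ℝ) - 1)
          + β * (∑ i ∈ Finset.Icc 1 m, (1 / (i : ℝ)) - Real.log m) := by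
      rw [mul_sub, ← add_sub_assoc, Finset.mul_sum, Finset.sum_div]
      congr 1
      simp only [G]
      rw [← Finset.sum_add_distrib, ← Finset.sum_add_distrib]
      refine Finset.sum_congr rfl fun i hi => ?_
      have hi0 : (i : ℝ) ≠ 0 := by
        have := (Finset.mem_Icc.1 hi).1
        positivity
      have e1 : X i ω / (((l : ℝ) - 1) * i) = (X i ω - l) / i / ((l : ℝ) - 1) + β * (1 / (i : ℝ)) := by
        rw [hβ]
        have := ha.ne'
        field_simp
        ring
      rw [hρ, e1]
      ring
    rw [e] at hω'
    have f1 : |(∑ i ∈ Finset.Icc 1 m, (X i ω - l) / i) / ((l : ℝ) - 1)| ≤ M / ((l : ℝ) - 1) := by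
      rw [abs_div, abs_of_pos ha]
      gcongr
    have f2 : |β * (∑ i ∈ Finset.Icc 1 m, (1 / (i : ℝ)) - Real.log m)| ≤ β := by
      rw [abs_mul, abs_of_pos hβ0]
      exact mul_le_of_le_one_right hβ0.le d3
    have f3 := (abs_add_le (G m ω + (∑ i ∈ Finset.Icc 1 m, (X i ω - l) / i) / ((l : ℝ) - 1))
      (β * (∑ i ∈ Finset.Icc 1 m, (1 / (i : ℝ)) - Real.log m)))
    have f4 := abs_add_le (G m ω) ((∑ i ∈ Finset.Icc 1 m, (X i ω - l) / i) / ((l : ℝ) - 1))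
    have f5 : (N + M / ((l : ℝ) - 1) + β) ≤ (N + M / ((l : ℝ) - 1) + β) * Real.log (Real.log m) :=
      le_mul_of_one_le_right (by positivity) hm1
    linarith
  have hBadle : μ Bad ≤ p * ENNReal.ofReal ε := by
    calc μ Bad ≤ _ := measure_mono hsub
      _ ≤ _ := measure_union_le _ _
      _ ≤ δ + δ := add_le_add hN ((pvt_cheb μ X l _ hX hE hV hind M hM0 m).trans hM)
      _ = _ := ENNReal.add_halves _
  rw [cond_apply hPm]
  calc (μ (Pos m))⁻¹ * μ (Pos m ∩ Bad) ≤ p⁻¹ * (p * ENNReal.ofReal ε) := by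
        gcongr
        exact (measure_mono Set.inter_subset_right).trans hBadle
    _ = ENNReal.ofReal ε := by
        rw [← mul_assoc, ENNReal.inv_mul_cancel hp0 hp1, one_mul]

end
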